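/- Let m > 0 and e be real constants and let K : ℝ³ × ℝ³ → ℝ be a symmetric kernel of class C¹, K(q, q') = K(q', q). Let Π and σ be momentum one-forms whose six component functions are smooth and compactly supported. Define the density f_Π = Σ_i (∂Π_i/∂p_i − ∂Πⁱ/∂q_i), the potential φ_Π(q) = e·∫ K(q, q')·f_Π(z') dμ(z'), and the momentum Lie–Poisson Hamiltonian H(Π) = ∫ ( Σ_i Π_i(z)·p_i/m − (e/2)·Σ_i Πⁱ(z)·∂φ_Π/∂q_i(q) ) dμ(z). Then the function ε ↦ H(Π + ε·σ) is differentiable at ε = 0 with derivative ∫ ( Σ_i σ_i(z)·p_i/m − e·Σ_i σⁱ(z)·∂φ_Π/∂q_i(q) ) dμ(z) = ∫ ⟨σ, X_h⟩ dμ, where h(z) = |p|²/(2m) + e·φ_Π(q); i.e., the variational derivative of H at Π is the Hamiltonian vector field X_h of the particle Hamiltonian. -/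

import Mathlib

open MeasureTheory

noncomputable section

/-- Position/momentum 3-space. -/
abbrev V3 : Type := Fin 3 → ℝ

/-- Phase space `ℝ³ × ℝ³` with coordinates `z = (q, p)`. -/
abbrev Phase : Type := V3 × V3

/-- Partial derivative in the `i`-th position variable `q i`. -/
def pq (i : Fin 3) (F : Phase → ℝ) (z : Phase) : ℝ :=
  deriv (fun s => F (Function.update z.1 i s, z.2)) (z.1 i)

/-- Partial derivative in the `i`-th momentum variable `p i`. -/
def pp (i : Fin 3) (F : Phase → ℝ) (z : Phase) : ℝ :=
  deriv (fun s => F (z.1, Function.update z.2 i s)) (z.2 i)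

/-- Partial derivative of a function on `ℝ³`. -/
def dq3 (i : Fin 3) (g : V3 → ℝ) (q : V3) : ℝ :=
  deriv (fun s => g (Function.update q i s)) (q i)

/-- Action of the Hamiltonian vector field of `a` on the function `F`:
`X_a(F) = Σᵢ (∂a/∂pᵢ ∂F/∂qᵢ − ∂a/∂qᵢ ∂F/∂pᵢ)`. -/
def Xact (a F : Phase → ℝ) (z : Phase) : ℝ :=
  ∑ i : Fin 3, (pp i a z * pq i F z - pq i a z * pp i F z)
/-- The plasma density of the momentum one-form with `dq`-components `A i` and
`dp`-components `B i`: `f = Σᵢ (∂Πᵢ/∂pᵢ − ∂Πⁱ/∂qᵢ)`. -/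
def dens (A B : Fin 3 → Phase → ℝ) (z : Phase) : ℝ :=
  ∑ i : Fin 3, (pp i (A i) z - pq i (B i) z)

/-- The potential `φ_Π(q) = e ∫ K(q,q') f_Π(z') dμ(z')`. -/
def pot (e : ℝ) (K : V3 → V3 → ℝ) (A B : Fin 3 → Phase → ℝ) (q : V3) : ℝ :=
  e * ∫ z : Phase, K q z.1 * dens A B z

/-- The momentum Lie–Poisson Hamiltonian
`H(Π) = ∫ ( Σᵢ Πᵢ(z) pᵢ/m − (e/2) Σᵢ Πⁱ(z) ∂φ_Π/∂qᵢ(q) ) dμ(z)`. -/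
def Ham (m e : ℝ) (K : V3 → V3 → ℝ) (A B : Fin 3 → Phase → ℝ) : ℝ :=
  ∫ z : Phase,
    ((∑ i : Fin 3, A i z * z.2 i / m)
      - (e / 2) * ∑ i : Fin 3, B i z * dq3 i (pot e K A B) z.1)

lemma hasDerivAt_update_single (x : V3) (i : Fin 3) :
    HasDerivAt (fun s => Function.update x i s) (Pi.single i 1) (x i) := by
  rw [hasDerivAt_pi]
  intro j
  rcases eq_or_ne j i with rfl | hj
  · simpa using hasDerivAt_id' (x j)
  · simpa [hj] using hasDerivAt_const (x i) (x j)

lemma pq_eq_fderiv {F : Phase → ℝ} {z : Phase} (hF : DifferentiableAt ℝ F z) (i : Fin 3) :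
    pq i F z = fderiv ℝ F z (Pi.single i 1, 0) := by
  have hF' : HasFDerivAt F (fderiv ℝ F z) (Function.update z.1 i (z.1 i), z.2) := by
    simpa using hF.hasFDerivAt
  exact (hF'.comp_hasDerivAt (z.1 i)
    ((hasDerivAt_update_single z.1 i).prodMk (hasDerivAt_const _ z.2))).deriv

lemma pp_eq_fderiv {F : Phase → ℝ} {z : Phase} (hF : DifferentiableAt ℝ F z) (i : Fin 3) :
    pp i F z = fderiv ℝ F z (0, Pi.single i 1) := by
  have hF' : HasFDerivAt F (fderiv ℝ F z) (z.1, Function.update z.2 i (z.2 i)) := by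
    simpa using hF.hasFDerivAt
  exact (hF'.comp_hasDerivAt (z.2 i)
    ((hasDerivAt_const _ z.1).prodMk (hasDerivAt_update_single z.2 i))).deriv

lemma dq3_eq_fderiv {g : V3 → ℝ} {q : V3} (hg : DifferentiableAt ℝ g q) (i : Fin 3) :
    dq3 i g q = fderiv ℝ g q (Pi.single i 1) := by
  have hg' : HasFDerivAt g (fderiv ℝ g q) (Function.update q i (q i)) := by
    simpa using hg.hasFDerivAt
  exact (hg'.comp_hasDerivAt (q i) (hasDerivAt_update_single q i)).deriv

lemma continuous_dq3 {g : V3 → ℝ} (hg : ContDiff ℝ 1 g) (i : Fin 3) :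
    Continuous (dq3 i g) := by
  have : dq3 i g = fun q => fderiv ℝ g q (Pi.single i 1) :=
    funext fun q => dq3_eq_fderiv (hg.differentiable one_ne_zero q) i
  rw [this]
  exact (hg.continuous_fderiv one_ne_zero).clm_apply continuous_const

lemma dq3_add_const_mul {g k : V3 → ℝ} (hg : ContDiff ℝ 1 g) (hk : ContDiff ℝ 1 k) (c : ℝ)
    (i : Fin 3) (q : V3) :
    dq3 i (fun x => g x + c * k x) q = dq3 i g q + c * dq3 i k q := by
  have hg' := hg.differentiable one_ne_zero q
  have hk' := hk.differentiable one_ne_zero q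
  rw [dq3_eq_fderiv (hg'.fun_add (hk'.const_mul c)), dq3_eq_fderiv hg', dq3_eq_fderiv hk',
    fderiv_fun_add hg' (hk'.const_mul c), fderiv_const_mul hk']
  simp

section Density

variable {A B A' B' : Fin 3 → Phase → ℝ}

lemma dens_eq_fderiv (hA : ∀ i, ContDiff ℝ 1 (A i)) (hB : ∀ i, ContDiff ℝ 1 (B i)) :
    dens A B = fun z => ∑ i : Fin 3, (fderiv ℝ (A i) z (0, Pi.single i 1)
      - fderiv ℝ (B i) z (Pi.single i 1, 0)) := by
  funext z
  refine Finset.sum_congr rfl fun i _ => ?_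
  rw [pp_eq_fderiv ((hA i).differentiable one_ne_zero z),
    pq_eq_fderiv ((hB i).differentiable one_ne_zero z)]

lemma continuous_dens (hA : ∀ i, ContDiff ℝ 1 (A i)) (hB : ∀ i, ContDiff ℝ 1 (B i)) :
    Continuous (dens A B) := by
  rw [dens_eq_fderiv hA hB]
  exact continuous_finsetSum _ fun i _ =>
    (((hA i).continuous_fderiv one_ne_zero).clm_apply continuous_const).sub
      (((hB i).continuous_fderiv one_ne_zero).clm_apply continuous_const)

lemma hasCompactSupport_finset_sum {ι X : Type*} [TopologicalSpace X] (s : Finset ι)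
    {f : ι → X → ℝ} (hf : ∀ i, HasCompactSupport (f i)) :
    HasCompactSupport fun x => ∑ i ∈ s, f i x := by
  classical
  induction s using Finset.induction_on with
  | empty => exact HasCompactSupport.zero
  | insert i s hi ih =>
    simp only [Finset.sum_insert hi]
    exact (hf i).add ih

lemma hasCompactSupport_dens (hA : ∀ i, ContDiff ℝ 1 (A i)) (hB : ∀ i, ContDiff ℝ 1 (B i))
    (hcA : ∀ i, HasCompactSupport (A i)) (hcB : ∀ i, HasCompactSupport (B i)) :
    HasCompactSupport (dens A B) := by
  rw [dens_eq_fderiv hA hB]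
  exact hasCompactSupport_finset_sum _ fun i =>
    ((hcA i).fderiv_apply ℝ _).sub ((hcB i).fderiv_apply ℝ _)

lemma dens_add_const_mul (hA : ∀ i, ContDiff ℝ 1 (A i)) (hB : ∀ i, ContDiff ℝ 1 (B i))
    (hA' : ∀ i, ContDiff ℝ 1 (A' i)) (hB' : ∀ i, ContDiff ℝ 1 (B' i)) (c : ℝ) (z : Phase) :
    dens (fun i z => A i z + c * A' i z) (fun i z => B i z + c * B' i z) z
      = dens A B z + c * dens A' B' z := by
  have key : ∀ {F G : Phase → ℝ}, ContDiff ℝ 1 F → ContDiff ℝ 1 G → ∀ v,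
      fderiv ℝ (fun z => F z + c * G z) z v = fderiv ℝ F z v + c * fderiv ℝ G z v := by
    intro F G hF hG v
    have hG' := hG.differentiable one_ne_zero z
    rw [fderiv_fun_add (hF.differentiable one_ne_zero z) (hG'.const_mul c), fderiv_const_mul hG']
    simp
  rw [dens_eq_fderiv (fun i => (hA i).add (contDiff_const.mul (hA' i)))
      (fun i => (hB i).add (contDiff_const.mul (hB' i))),
    dens_eq_fderiv hA hB, dens_eq_fderiv hA' hB']
  simp only [key (hA _) (hA' _), key (hB _) (hB' _), Finset.mul_sum, ← Finset.sum_add_distrib]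
  exact Finset.sum_congr rfl fun i _ => by ring

lemma integrable_mul_of_hasCompactSupport {f g : Phase → ℝ} (hf : Continuous f)
    (hg : Continuous g) (hcf : HasCompactSupport f) : Integrable fun z => f z * g z :=
  (hf.mul hg).integrable_of_hasCompactSupport hcf.mul_right

/-- Integration by parts against a function pulled back from position space. -/
lemma integral_fderiv_mul_comp_fst {F : Phase → ℝ} {φ : V3 → ℝ} (hF : ContDiff ℝ 1 F)
    (hcF : HasCompactSupport F) (hφ : ContDiff ℝ 1 φ) (v : Phase) :
    ∫ z, fderiv ℝ F z v * φ z.1 = -∫ z, F z * fderiv ℝ φ z.1 v.1 := by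
  have hd := hφ.differentiable one_ne_zero
  have hfst : ∀ z : Phase, HasFDerivAt (fun z : Phase => φ z.1)
      ((fderiv ℝ φ z.1).comp (ContinuousLinearMap.fst ℝ V3 V3)) z := fun z =>
    (hd z.1).hasFDerivAt.comp z hasFDerivAt_fst
  have hφ' : Continuous fun z : Phase => φ z.1 := hφ.continuous.comp continuous_fst
  have hdφ : Continuous fun z : Phase => fderiv ℝ φ z.1 v.1 :=
    ((hφ.continuous_fderiv one_ne_zero).comp continuous_fst).clm_apply continuous_const
  have hdF : Continuous fun z => fderiv ℝ F z v :=
    (hF.continuous_fderiv one_ne_zero).clm_apply continuous_const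
  have : (volume : Measure Phase).IsAddHaarMeasure :=
    Measure.prod.instIsAddHaarMeasure (volume : Measure V3) (volume : Measure V3)
  have h := integral_mul_fderiv_eq_neg_fderiv_mul_of_integrable (μ := (volume : Measure Phase))
    (f := F) (g := fun z : Phase => φ z.1) (v := v)
    (integrable_mul_of_hasCompactSupport hdF hφ' (hcF.fderiv_apply ℝ v))
    (by simpa [(hfst _).fderiv] using integrable_mul_of_hasCompactSupport hF.continuous hdφ hcF)
    (integrable_mul_of_hasCompactSupport hF.continuous hφ' hcF)
    (fun z _ => hF.differentiable one_ne_zero z) (fun z _ => (hfst z).differentiableAt)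
  simp only [(hfst _).fderiv, ContinuousLinearMap.comp_apply, ContinuousLinearMap.coe_fst'] at h
  rw [h, neg_neg]

lemma integral_sum_mul_dq3 (hA : ∀ i, ContDiff ℝ 1 (A i)) (hB : ∀ i, ContDiff ℝ 1 (B i))
    (hcA : ∀ i, HasCompactSupport (A i)) (hcB : ∀ i, HasCompactSupport (B i))
    {φ : V3 → ℝ} (hφ : ContDiff ℝ 1 φ) :
    ∫ z : Phase, ∑ i : Fin 3, B i z * dq3 i φ z.1 = ∫ z : Phase, dens A B z * φ z.1 := by
  have hφ' : Continuous fun z : Phase => φ z.1 := hφ.continuous.comp continuous_fst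
  have hint : ∀ {F : Phase → ℝ}, ContDiff ℝ 1 F → HasCompactSupport F → ∀ v,
      Integrable fun z => fderiv ℝ F z v * φ z.1 := fun hF hcF v =>
    integrable_mul_of_hasCompactSupport
      ((hF.continuous_fderiv one_ne_zero).clm_apply continuous_const) hφ' (hcF.fderiv_apply ℝ v)
  rw [dens_eq_fderiv hA hB]
  simp only [Finset.sum_mul, sub_mul]
  have hdφ : ∀ i, Continuous fun z : Phase => dq3 i φ z.1 := fun i =>
    (continuous_dq3 hφ i).comp continuous_fst
  rw [integral_finsetSum _ fun i _ => integrable_mul_of_hasCompactSupport (hB i).continuous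
      (hdφ i) (hcB i),
    integral_finsetSum _ fun i _ => (hint (hA i) (hcA i) _).sub' (hint (hB i) (hcB i) _)]
  refine Finset.sum_congr rfl fun i _ => ?_
  rw [integral_sub (hint (hA i) (hcA i) _) (hint (hB i) (hcB i) _),
    integral_fderiv_mul_comp_fst (hA i) (hcA i) hφ, integral_fderiv_mul_comp_fst (hB i) (hcB i) hφ]
  simp [dq3_eq_fderiv (hφ.differentiable one_ne_zero _)]

end Density

section Potential

variable {K : V3 → V3 → ℝ}

lemma contDiff_integral_kernel (hK : ContDiff ℝ 1 fun w : V3 × V3 => K w.1 w.2)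
    {ρ : Phase → ℝ} (hρ : Continuous ρ) (hcρ : HasCompactSupport ρ) :
    ContDiff ℝ 1 fun q => ∫ z : Phase, K q z.1 * ρ z := by
  let D : V3 → Phase → V3 →L[ℝ] ℝ := fun q z =>
    ρ z • (fderiv ℝ (fun w : V3 × V3 => K w.1 w.2) (q, z.1)).comp (ContinuousLinearMap.inl ℝ V3 V3)
  have hD : Continuous D.uncurry := by
    refine (hρ.comp continuous_snd).smul (Continuous.clm_comp ?_ continuous_const)
    exact (hK.continuous_fderiv one_ne_zero).comp
      (continuous_fst.prodMk (continuous_fst.comp continuous_snd))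
  have hF : ∀ q, Continuous fun z : Phase => K q z.1 * ρ z := fun q =>
    (hK.continuous.comp (continuous_const.prodMk continuous_fst)).mul hρ
  have hDρ : ∀ q z, z ∉ tsupport ρ → D q z = 0 := fun q z hz => by
    simp [D, image_eq_zero_of_notMem_tsupport hz]
  refine contDiff_one_iff_hasFDerivAt.2 ⟨fun q => ∫ z, D q z, ?_, fun q => ?_⟩
  · rw [← continuousOn_univ]
    exact continuousOn_integral_of_compact_support hcρ.isCompact hD.continuousOn
      fun q z _ hz => hDρ q z hz
  · obtain ⟨M, hM⟩ := ((isCompact_closedBall q 1).prod hcρ.isCompact).exists_bound_of_continuousOn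
      hD.continuousOn
    refine hasFDerivAt_integral_of_dominated_of_fderiv_le (F := fun q z => K q z.1 * ρ z) (F' := D)
      (bound := (tsupport ρ).indicator fun _ => M) (Metric.closedBall_mem_nhds q one_pos)
      (.of_forall fun x => (hF x).aestronglyMeasurable)
      ((hF q).integrable_of_hasCompactSupport hcρ.mul_left)
      (hD.comp (continuous_const.prodMk continuous_id)).aestronglyMeasurable
      (.of_forall fun z x hx => ?_)
      ((integrable_indicator_iff (isClosed_tsupport ρ).measurableSet).2
        (integrableOn_const hcρ.isCompact.measure_ne_top))
      (.of_forall fun z x _ => ?_)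
    · by_cases hz : z ∈ tsupport ρ
      · simpa [hz] using hM (x, z) ⟨hx, hz⟩
      · simp [hz, hDρ x z hz]
    · have h₁ : HasFDerivAt (fun x : V3 => (x, z.1)) (ContinuousLinearMap.inl ℝ V3 V3) x :=
        hasFDerivAt_prodMk_left x z.1
      exact ((hK.differentiable one_ne_zero (x, z.1)).hasFDerivAt.comp x h₁).mul_const (ρ z)

variable {A B A' B' : Fin 3 → Phase → ℝ}

lemma contDiff_pot (e : ℝ) (hK : ContDiff ℝ 1 fun w : V3 × V3 => K w.1 w.2)
    (hA : ∀ i, ContDiff ℝ 1 (A i)) (hB : ∀ i, ContDiff ℝ 1 (B i))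
    (hcA : ∀ i, HasCompactSupport (A i)) (hcB : ∀ i, HasCompactSupport (B i)) :
    ContDiff ℝ 1 (pot e K A B) :=
  contDiff_const.mul <| contDiff_integral_kernel hK (continuous_dens hA hB)
    (hasCompactSupport_dens hA hB hcA hcB)

lemma pot_add_const_mul (e : ℝ) (hK : ContDiff ℝ 1 fun w : V3 × V3 => K w.1 w.2)
    (hA : ∀ i, ContDiff ℝ 1 (A i)) (hB : ∀ i, ContDiff ℝ 1 (B i))
    (hcA : ∀ i, HasCompactSupport (A i)) (hcB : ∀ i, HasCompactSupport (B i))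
    (hA' : ∀ i, ContDiff ℝ 1 (A' i)) (hB' : ∀ i, ContDiff ℝ 1 (B' i))
    (hcA' : ∀ i, HasCompactSupport (A' i)) (hcB' : ∀ i, HasCompactSupport (B' i)) (c : ℝ) :
    pot e K (fun i z => A i z + c * A' i z) (fun i z => B i z + c * B' i z)
      = fun q => pot e K A B q + c * pot e K A' B' q := by
  funext q
  have hKq : Continuous fun z : Phase => K q z.1 :=
    hK.continuous.comp (continuous_const.prodMk continuous_fst)
  have h₁ : Integrable fun z : Phase => K q z.1 * dens A B z :=
    (hKq.mul (continuous_dens hA hB)).integrable_of_hasCompactSupport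
      (hasCompactSupport_dens hA hB hcA hcB).mul_left
  have h₂ : Integrable fun z : Phase => K q z.1 * dens A' B' z :=
    (hKq.mul (continuous_dens hA' hB')).integrable_of_hasCompactSupport
      (hasCompactSupport_dens hA' hB' hcA' hcB').mul_left
  simp only [pot, dens_add_const_mul hA hB hA' hB', mul_add, mul_left_comm _ c]
  rw [integral_add h₁ (h₂.const_mul c), integral_const_mul]
  ring

/-- Reciprocity: the interaction energy of two densities is symmetric. -/
lemma integral_dens_mul_pot_comm (e : ℝ) (hK : Continuous fun w : V3 × V3 => K w.1 w.2)
    (hKsymm : ∀ q q', K q q' = K q' q)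
    (hA : ∀ i, ContDiff ℝ 1 (A i)) (hB : ∀ i, ContDiff ℝ 1 (B i))
    (hcA : ∀ i, HasCompactSupport (A i)) (hcB : ∀ i, HasCompactSupport (B i))
    (hA' : ∀ i, ContDiff ℝ 1 (A' i)) (hB' : ∀ i, ContDiff ℝ 1 (B' i))
    (hcA' : ∀ i, HasCompactSupport (A' i)) (hcB' : ∀ i, HasCompactSupport (B' i)) :
    ∫ z : Phase, dens A B z * pot e K A' B' z.1 = ∫ z : Phase, dens A' B' z * pot e K A B z.1 := by
  have hρ := continuous_dens hA hB
  have hρ' := continuous_dens hA' hB'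
  have hcρ := hasCompactSupport_dens hA hB hcA hcB
  have hcρ' := hasCompactSupport_dens hA' hB' hcA' hcB'
  let f : Phase → Phase → ℝ := fun z z' => dens A B z * (e * (K z.1 z'.1 * dens A' B' z'))
  have hKc : Continuous fun w : Phase × Phase => K w.1.1 w.2.1 :=
    hK.comp ((continuous_fst.comp continuous_fst).prodMk (continuous_fst.comp continuous_snd))
  have hf : Continuous f.uncurry :=
    (hρ.comp continuous_fst).mul
      (continuous_const.mul (hKc.mul (hρ'.comp continuous_snd)))
  have hcf : HasCompactSupport f.uncurry := by
    refine HasCompactSupport.intro (hcρ.isCompact.prod hcρ'.isCompact) fun w hw => ?_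
    rw [Set.mem_prod, not_and_or] at hw
    rcases hw with hw | hw <;> simp [f, Function.uncurry, image_eq_zero_of_notMem_tsupport hw]
  have h := integral_integral_swap_of_hasCompactSupport hf hcf
    (μ := (volume : Measure Phase)) (ν := (volume : Measure Phase))
  simp only [pot, ← integral_const_mul]
  refine h.trans (integral_congr_ae (.of_forall fun z => integral_congr_ae (.of_forall fun z' => ?_)))
  simp only [f, hKsymm z'.1 z.1]
  ring

end Potential

/-- the variational derivative of the momentum Lie–Poisson Hamiltonian
`H` at the momentum one-form `Π` (components `Pq i`, `Pp i`) in the direction of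
`σ` (components `Sq i`, `Sp i`) is `∫ ⟨σ, X_h⟩ dμ` with `h = |p|²/(2m) + e φ_Π(q)`. -/
theorem variational_derivative_of_momentum_hamiltonian
    (m e : ℝ) (hm : 0 < m)
    (K : V3 → V3 → ℝ)
    (hK : ContDiff ℝ 1 (fun w : V3 × V3 => K w.1 w.2))
    (hKsymm : ∀ q q', K q q' = K q' q)
    (Pq Pp Sq Sp : Fin 3 → Phase → ℝ)
    (hPq : ∀ i, ContDiff ℝ (⊤ : ℕ∞) (Pq i)) (hPp : ∀ i, ContDiff ℝ (⊤ : ℕ∞) (Pp i))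
    (hSq : ∀ i, ContDiff ℝ (⊤ : ℕ∞) (Sq i)) (hSp : ∀ i, ContDiff ℝ (⊤ : ℕ∞) (Sp i))
    (hcPq : ∀ i, HasCompactSupport (Pq i)) (hcPp : ∀ i, HasCompactSupport (Pp i))
    (hcSq : ∀ i, HasCompactSupport (Sq i)) (hcSp : ∀ i, HasCompactSupport (Sp i))
    (h : Phase → ℝ)
    (hh : ∀ z, h z = (∑ i : Fin 3, (z.2 i) ^ 2) / (2 * m) + e * pot e K Pq Pp z.1) :
    HasDerivAt
        (fun ε : ℝ => Ham m e K
          (fun i z => Pq i z + ε * Sq i z) (fun i z => Pp i z + ε * Sp i z))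
        (∫ z : Phase,
          ((∑ i : Fin 3, Sq i z * z.2 i / m)
            - e * ∑ i : Fin 3, Sp i z * dq3 i (pot e K Pq Pp) z.1)) 0
      ∧ (∫ z : Phase,
          ((∑ i : Fin 3, Sq i z * z.2 i / m)
            - e * ∑ i : Fin 3, Sp i z * dq3 i (pot e K Pq Pp) z.1))
        = ∫ z : Phase, ∑ i : Fin 3, (Sq i z * pp i h z - Sp i z * pq i h z) := by
  have h1 : (1 : WithTop ℕ∞) ≤ ((⊤ : ℕ∞) : WithTop ℕ∞) := by exact_mod_cast le_top
  replace hPq := fun i => (hPq i).of_le h1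
  replace hPp := fun i => (hPp i).of_le h1
  replace hSq := fun i => (hSq i).of_le h1
  replace hSp := fun i => (hSp i).of_le h1
  set φ := pot e K Pq Pp with hφdef
  set ψ := pot e K Sq Sp with hψdef
  have hφ : ContDiff ℝ 1 φ := contDiff_pot e hK hPq hPp hcPq hcPp
  have hψ : ContDiff ℝ 1 ψ := contDiff_pot e hK hSq hSp hcSq hcSp
  have hkin : ∀ {A : Fin 3 → Phase → ℝ}, (∀ i, ContDiff ℝ 1 (A i)) →
      (∀ i, HasCompactSupport (A i)) →
      Integrable fun z : Phase => ∑ i : Fin 3, A i z * z.2 i / m := by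
    intro A hA hcA
    simp only [mul_div_assoc]
    exact integrable_finsetSum _ fun i _ => integrable_mul_of_hasCompactSupport (hA i).continuous
      (by fun_prop) (hcA i)
  have hpair : ∀ {B : Fin 3 → Phase → ℝ} {g : V3 → ℝ}, (∀ i, ContDiff ℝ 1 (B i)) →
      (∀ i, HasCompactSupport (B i)) → ContDiff ℝ 1 g →
      Integrable fun z : Phase => ∑ i : Fin 3, B i z * dq3 i g z.1 := fun hB hcB hg =>
    integrable_finsetSum _ fun i _ => integrable_mul_of_hasCompactSupport (hB i).continuous
      ((continuous_dq3 hg i).comp continuous_fst) (hcB i)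
  have hrec : ∫ z : Phase, ∑ i : Fin 3, Pp i z * dq3 i ψ z.1
      = ∫ z : Phase, ∑ i : Fin 3, Sp i z * dq3 i φ z.1 := by
    rw [integral_sum_mul_dq3 hPq hPp hcPq hcPp hψ, integral_sum_mul_dq3 hSq hSp hcSq hcSp hφ]
    exact integral_dens_mul_pot_comm e hK.continuous hKsymm hPq hPp hcPq hcPp hSq hSp hcSq hcSp
  have hHam : ∀ ε : ℝ, Ham m e K (fun i z => Pq i z + ε * Sq i z) (fun i z => Pp i z + ε * Sp i z)
      = Ham m e K Pq Pp
        + ε * (∫ z : Phase, ((∑ i : Fin 3, Sq i z * z.2 i / m)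
            - e * ∑ i : Fin 3, Sp i z * dq3 i φ z.1))
        + ε ^ 2 * (-(e / 2) * ∫ z : Phase, ∑ i : Fin 3, Sp i z * dq3 i ψ z.1) := by
    intro ε
    have hsplit : ∀ z : Phase,
        ((∑ i : Fin 3, (Pq i z + ε * Sq i z) * z.2 i / m)
          - (e / 2) * ∑ i : Fin 3, (Pp i z + ε * Sp i z) * (dq3 i φ z.1 + ε * dq3 i ψ z.1))
        = ((∑ i : Fin 3, Pq i z * z.2 i / m) - (e / 2) * ∑ i : Fin 3, Pp i z * dq3 i φ z.1)
          + (ε * (∑ i : Fin 3, Sq i z * z.2 i / m)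
            - ε * (e / 2) * (∑ i : Fin 3, Sp i z * dq3 i φ z.1)
            - ε * (e / 2) * (∑ i : Fin 3, Pp i z * dq3 i ψ z.1)
            - ε ^ 2 * (e / 2) * (∑ i : Fin 3, Sp i z * dq3 i ψ z.1)) := by
      intro z
      simp only [Fin.sum_univ_three]
      ring
    have iS := hkin hSq hcSq
    have iSφ := hpair hSp hcSp hφ
    have iPψ := hpair hPp hcPp hψ
    have iSψ := hpair hSp hcSp hψ
    simp only [Ham]
    rw [pot_add_const_mul e hK hPq hPp hcPq hcPp hSq hSp hcSq hcSp ε]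
    simp only [← hφdef, ← hψdef, dq3_add_const_mul hφ hψ, hsplit]
    rw [integral_add ((hkin hPq hcPq).sub' ((hpair hPp hcPp hφ).const_mul _))
        ((((iS.const_mul _).sub' (iSφ.const_mul _)).sub' (iPψ.const_mul _)).sub' (iSψ.const_mul _)),
      integral_sub (((iS.const_mul _).sub' (iSφ.const_mul _)).sub' (iPψ.const_mul _))
        (iSψ.const_mul _),
      integral_sub ((iS.const_mul _).sub' (iSφ.const_mul _)) (iPψ.const_mul _),
      integral_sub (iS.const_mul _) (iSφ.const_mul _), integral_sub iS (iSφ.const_mul _)]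
    simp only [integral_const_mul, hrec]
    ring
  constructor
  · simp only [hHam]
    have hd := (((hasDerivAt_id (0 : ℝ)).mul_const (∫ z : Phase,
        ((∑ i : Fin 3, Sq i z * z.2 i / m) - e * ∑ i : Fin 3, Sp i z * dq3 i φ z.1))).const_add
        (Ham m e K Pq Pp)).fun_add ((hasDerivAt_pow 2 (0 : ℝ)).mul_const
        (-(e / 2) * ∫ z : Phase, ∑ i : Fin 3, Sp i z * dq3 i ψ z.1))
    simpa using hd
  · have hpq : ∀ i z, pq i h z = e * dq3 i φ z.1 := by
      intro i z
      simp only [pq, hh, deriv_const_add, deriv_const_mul_field, dq3]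
    have hpp : ∀ i z, pp i h z = z.2 i / m := by
      intro i z
      have hsum : HasDerivAt (fun s => ∑ j : Fin 3, (Function.update z.2 i s j) ^ 2)
          (∑ j : Fin 3, 2 * z.2 j * (Pi.single i 1 : V3) j) (z.2 i) := by
        refine HasDerivAt.fun_sum fun j _ => ?_
        simpa using (hasDerivAt_pi.1 (hasDerivAt_update_single z.2 i) j).fun_pow 2
      have := ((hsum.div_const (2 * m)).add_const (e * φ z.1)).deriv
      simp only [pp, hh]
      rw [this]
      simp only [Pi.single_apply, mul_ite, mul_one, mul_zero, Finset.sum_ite_eq', Finset.mem_univ,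
        if_true]
      field_simp
    refine integral_congr_ae (.of_forall fun z => ?_)
    simp only [hpq, hpp, Fin.sum_univ_three]
    ring
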